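/- arXiv:2208.03085 — 5 statements merged into one kernel-verified Lean document; each statement's English description precedes it below -/
import Mathlib

section
/- Let A be a nonzero real n×p matrix, let μ_max be the largest eigenvalue of AAᵀ and μ_min the smallest positive eigenvalue of AAᵀ. Let 0 < η < 1/√(3·μ_max) and let (x_t, y_t)_{t≥-1} be the OGDA sequence for the zero-sum game xᵀAy with step η and arbitrary initialization (x₀, y₀, x₋₁, y₋₁) ∈ ℝⁿ×ℝᵖ×ℝⁿ×ℝᵖ. Then (x_t, y_t) converges as t → ∞, the limit x_∞ is the orthogonal projection of x₀ onto Ker(Aᵀ), and the limit y_∞ is the orthogonal projection of y₀ onto Ker(A); in particular the limit is a Nash equilibrium (Aᵀx_∞ = 0 and A y_∞ = 0). -/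
open Matrix Filter

noncomputable section

/-- Squared Euclidean norm of a vector in `ℝ^n`. -/
def sqnorm {n : ℕ} (v : Fin n → ℝ) : ℝ := ∑ i, (v i) ^ 2

section SkewOGDA

variable {E : Type*} [NormedAddCommGroup E] [InnerProductSpace ℝ E]

/-- Lyapunov function of the OGDA iteration `z (t + 2) = z (t + 1) + 2 K z (t + 1) - K z t`,
evaluated at two consecutive iterates `a = z t` and `b = z (t + 1)`. -/
def ogdaEnergy (K : E →ₗ[ℝ] E) (a b : E) : ℝ :=
  ‖b - K a‖ ^ 2 + 3 * ‖K b - K a‖ ^ 2 - 6 * ‖K (K a)‖ ^ 2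

lemma inner_map_self_eq_zero_of_skew {K : E →ₗ[ℝ] E}
    (hskew : ∀ u v, inner ℝ (K u) v = -inner ℝ u (K v)) (u : E) : inner ℝ (K u) u = 0 := by
  have h := hskew u u
  rw [real_inner_comm] at h
  rw [real_inner_comm]
  linarith

lemma ogdaEnergy_nonneg {K : E →ₗ[ℝ] E}
    (hskew : ∀ u v, inner ℝ (K u) v = -inner ℝ u (K v))
    (hK : ∀ u, 3 * ‖K u‖ ^ 2 ≤ ‖u‖ ^ 2) (a b : E) : 0 ≤ ogdaEnergy K a b := by
  obtain ⟨v, hv⟩ : ∃ v, v = b - K a := ⟨_, rfl⟩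
  obtain ⟨g, hg⟩ : ∃ g, g = K a := ⟨_, rfl⟩
  obtain rfl : b = v + g := by rw [hv, hg]; abel
  have e1 : ogdaEnergy K a (v + g) =
      ‖v‖ ^ 2 + 3 * ‖K v + K g - g‖ ^ 2 - 6 * ‖K g‖ ^ 2 := by
    simp [ogdaEnergy, ← hg]
  have h1 := inner_map_self_eq_zero_of_skew hskew g
  have h2 := inner_map_self_eq_zero_of_skew hskew (K v)
  have h3 := hskew (K v) g
  have h4 := hK v
  have h5 := hK (K v)
  have h6 := hK g
  have h7 : 0 ≤ ‖(2 : ℝ) • g - (3 : ℝ) • (K (K v) + K v)‖ ^ 2 := sq_nonneg _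
  rw [e1]
  simp only [← real_inner_self_eq_norm_sq, inner_add_left, inner_add_right, inner_sub_left,
    inner_sub_right, inner_smul_left, inner_smul_right, conj_trivial] at *
  have c1 := real_inner_comm (K g) g
  have c2 := real_inner_comm (K (K v)) (K v)
  have c3 := real_inner_comm (K (K v)) g
  have c4 := real_inner_comm (K v) g
  have c5 := real_inner_comm (K v) (K g)
  linarith

lemma ogdaEnergy_step {K : E →ₗ[ℝ] E}
    (hskew : ∀ u v, inner ℝ (K u) v = -inner ℝ u (K v)) (a b : E) :
    ogdaEnergy K b (b + (2 : ℝ) • K b - K a) = ogdaEnergy K a b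
      - (‖K a‖ ^ 2 - 3 * ‖K (K a)‖ ^ 2) - 2 * (‖K b - K a‖ ^ 2 - 3 * ‖K (K b - K a)‖ ^ 2) := by
  have h1 := inner_map_self_eq_zero_of_skew hskew b
  simp only [ogdaEnergy, map_add, map_sub, map_smul]
  simp only [← real_inner_self_eq_norm_sq, inner_add_left, inner_add_right, inner_sub_left,
    inner_sub_right, inner_smul_left, inner_smul_right, conj_trivial]
  have c1 := real_inner_comm (K b) b
  have c2 := real_inner_comm (K a) b
  have c3 := real_inner_comm (K a) (K b)
  have c4 := real_inner_comm (K (K a)) (K b)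
  have c5 := real_inner_comm (K (K a)) (K (K b))
  have c6 := real_inner_comm (K (K b)) (K b)
  have c7 := real_inner_comm (K (K b)) (K a)
  have c8 := real_inner_comm (K (K a)) (K a)
  linarith

lemma tendsto_map_ogda {K : E →ₗ[ℝ] E}
    (hskew : ∀ u v, inner ℝ (K u) v = -inner ℝ u (K v)) {κ : ℝ} (hκ : 3 * κ < 1)
    (hK : ∀ u, ‖K u‖ ^ 2 ≤ κ * ‖u‖ ^ 2) {z : ℕ → E}
    (hz : ∀ t, z (t + 2) = z (t + 1) + (2 : ℝ) • K (z (t + 1)) - K (z t)) :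
    Tendsto (fun t => K (z t)) atTop (nhds 0) := by
  have hK3 : ∀ u, 3 * ‖K u‖ ^ 2 ≤ ‖u‖ ^ 2 := fun u => by
    nlinarith [hK u, sq_nonneg ‖u‖]
  have hstep : ∀ t, (1 - 3 * κ) * ‖K (z t)‖ ^ 2 ≤
      ogdaEnergy K (z t) (z (t + 1)) - ogdaEnergy K (z (t + 1)) (z (t + 2)) := fun t => by
    rw [hz t, ogdaEnergy_step hskew]
    linarith [hK (K (z t)), hK3 (K (z (t + 1)) - K (z t))]
  have hsum : Summable fun t => (1 - 3 * κ) * ‖K (z t)‖ ^ 2 := by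
    refine summable_of_sum_range_le (c := ogdaEnergy K (z 0) (z 1))
      (fun t => mul_nonneg (by linarith) (sq_nonneg _)) fun m => ?_
    calc ∑ t ∈ Finset.range m, (1 - 3 * κ) * ‖K (z t)‖ ^ 2
        ≤ ∑ t ∈ Finset.range m, (ogdaEnergy K (z t) (z (t + 1))
            - ogdaEnergy K (z (t + 1)) (z (t + 2))) := Finset.sum_le_sum fun t _ => hstep t
      _ = ogdaEnergy K (z 0) (z 1) - ogdaEnergy K (z m) (z (m + 1)) :=
          Finset.sum_range_sub' (fun t => ogdaEnergy K (z t) (z (t + 1))) m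
      _ ≤ _ := by linarith [ogdaEnergy_nonneg hskew hK3 (z m) (z (m + 1))]
  have hsq : Tendsto (fun t => ‖K (z t)‖ ^ 2) atTop (nhds 0) :=
    ((summable_mul_left_iff (by linarith)).1 hsum).tendsto_atTop_zero
  rw [tendsto_zero_iff_norm_tendsto_zero]
  simpa using hsq.sqrt

lemma tendsto_ogda_starProjection_ker [FiniteDimensional ℝ E] {K : E →ₗ[ℝ] E}
    (hskew : ∀ u v, inner ℝ (K u) v = -inner ℝ u (K v)) {κ : ℝ} (hκ : 3 * κ < 1)
    (hK : ∀ u, ‖K u‖ ^ 2 ≤ κ * ‖u‖ ^ 2) {z : ℕ → E}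
    (hz0 : z 1 - z 0 ∈ K.range)
    (hz : ∀ t, z (t + 2) = z (t + 1) + (2 : ℝ) • K (z (t + 1)) - K (z t)) :
    Tendsto z atTop (nhds (K.ker.starProjection (z 0))) := by
  have hrange : K.range ≤ K.kerᗮ := by
    rintro _ ⟨u, rfl⟩ w hw
    rw [real_inner_comm, hskew, LinearMap.mem_ker.1 hw, inner_zero_right, neg_zero]
  have hdiff : ∀ t, z (t + 1) - z t ∈ K.range := by
    rintro (_ | t)
    · exact hz0
    · exact ⟨(2 : ℝ) • z (t + 1) - z t, by rw [hz, map_sub, map_smul]; abel⟩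
  have hmem : ∀ t, z t - K.ker.starProjection (z 0) ∈ K.kerᗮ := by
    intro t
    induction t with
    | zero => exact Submodule.sub_starProjection_mem_orthogonal _
    | succ t ih => simpa using add_mem (hrange (hdiff t)) ih
  have hinj : (K.domRestrict K.kerᗮ).ker = ⊥ := by
    refine LinearMap.ker_eq_bot'.2 fun u hu => Subtype.ext ?_
    exact inner_self_eq_zero.1 (u.2 u hu)
  obtain ⟨C, -, hC⟩ := (K.domRestrict K.kerᗮ).exists_antilipschitzWith hinj
  rw [tendsto_iff_norm_sub_tendsto_zero]
  have hlim := ((tendsto_map_ogda hskew hκ hK hz).norm).const_mul (C : ℝ)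
  rw [norm_zero, mul_zero] at hlim
  refine squeeze_zero (fun _ => norm_nonneg _) (fun t => ?_) hlim
  have h := ZeroHomClass.bound_of_antilipschitz _ hC ⟨_, hmem t⟩
  have hker : K (K.ker.starProjection (z 0)) = 0 :=
    LinearMap.mem_ker.1 (Submodule.starProjection_apply_mem _ _)
  simpa [hker] using h

end SkewOGDA

lemma dotProduct_transpose_mulVec_self_le {m n : Type*} [Fintype m] [Fintype n] [DecidableEq m]
    {A : Matrix m n ℝ} {μ : ℝ} (hμ : ∀ a ∈ spectrum ℝ (A * Aᵀ), a ≤ μ) (x : m → ℝ) :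
    (Aᵀ *ᵥ x) ⬝ᵥ (Aᵀ *ᵥ x) ≤ μ * (x ⬝ᵥ x) := by
  have hpos : (algebraMap ℝ (Matrix m m ℝ) μ - A * Aᵀ).PosSemidef := by
    refine posSemidef_iff_isHermitian_and_spectrum_nonneg.2 ⟨?_, ?_⟩
    · rw [Algebra.algebraMap_eq_smul_one]
      simp [IsHermitian]
    · rw [← spectrum.singleton_sub_eq]
      rintro _ ⟨_, rfl, b, hb, rfl⟩
      exact sub_nonneg.2 (hμ b hb)
  have h := hpos.dotProduct_mulVec_nonneg x
  rw [Algebra.algebraMap_eq_smul_one, sub_mulVec, smul_mulVec, one_mulVec, star_trivial,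
    dotProduct_sub, dotProduct_smul, ← mulVec_mulVec, dotProduct_mulVec x A,
    ← mulVec_transpose, smul_eq_mul] at h
  linarith

lemma dotProduct_mulVec_self_le {m n : Type*} [Fintype m] [Fintype n]
    {A : Matrix m n ℝ} {μ : ℝ} (hμ0 : 0 ≤ μ)
    (hμ : ∀ x, (Aᵀ *ᵥ x) ⬝ᵥ (Aᵀ *ᵥ x) ≤ μ * (x ⬝ᵥ x)) (y : n → ℝ) :
    (A *ᵥ y) ⬝ᵥ (A *ᵥ y) ≤ μ * (y ⬝ᵥ y) := by
  have h1 := hμ (A *ᵥ y)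
  have h2 : (A *ᵥ y) ⬝ᵥ (A *ᵥ y) = y ⬝ᵥ (Aᵀ *ᵥ (A *ᵥ y)) := by
    rw [dotProduct_comm y, mulVec_transpose, dotProduct_mulVec]
  have h3 : (y ⬝ᵥ (Aᵀ *ᵥ (A *ᵥ y))) ^ 2 ≤
      (y ⬝ᵥ y) * ((Aᵀ *ᵥ (A *ᵥ y)) ⬝ᵥ (Aᵀ *ᵥ (A *ᵥ y))) := by
    simpa [dotProduct, sq] using
      Finset.sum_mul_sq_le_sq_mul_sq Finset.univ y (Aᵀ *ᵥ (A *ᵥ y))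
  have h4 : 0 ≤ y ⬝ᵥ y := dotProduct_self_star_nonneg y
  have h5 : 0 ≤ (A *ᵥ y) ⬝ᵥ (A *ᵥ y) := dotProduct_self_star_nonneg _
  rcases h5.eq_or_lt with h0 | h0
  · rw [← h0]
    positivity
  · rw [← h2] at h3
    have := mul_le_mul_of_nonneg_left h1 h4
    nlinarith

lemma exists_eq_toLp_sumElim {m n : Type*} (u : EuclideanSpace ℝ (m ⊕ n)) :
    ∃ (x : m → ℝ) (y : n → ℝ), u = WithLp.toLp 2 (Sum.elim x y) :=
  ⟨fun i => u (.inl i), fun j => u (.inr j), by ext (i | j) <;> rfl⟩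

lemma inner_toLp_sumElim {m n : Type*} [Fintype m] [Fintype n] (x x' : m → ℝ) (y y' : n → ℝ) :
    inner ℝ (WithLp.toLp 2 (Sum.elim x y)) (WithLp.toLp 2 (Sum.elim x' y')) =
      x ⬝ᵥ x' + y ⬝ᵥ y' := by
  rw [EuclideanSpace.inner_toLp_toLp, star_trivial, dotProduct_comm, sumElim_dotProduct_sumElim]

/-- The linear operator `(x, y) ↦ (η A y, -η Aᵀ x)`. -/
def skewOperator {m n : Type*} [Fintype m] [Fintype n] [DecidableEq m] [DecidableEq n]
    (A : Matrix m n ℝ) (η : ℝ) : EuclideanSpace ℝ (m ⊕ n) →ₗ[ℝ] EuclideanSpace ℝ (m ⊕ n) :=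
  toEuclideanLin (fromBlocks 0 (η • A) (-(η • Aᵀ)) 0)

section SkewOperator

variable {m n : Type*} [Fintype m] [Fintype n] [DecidableEq m] [DecidableEq n]

lemma skewOperator_toLp (A : Matrix m n ℝ) (η : ℝ) (x : m → ℝ) (y : n → ℝ) :
    skewOperator A η (WithLp.toLp 2 (Sum.elim x y)) =
      WithLp.toLp 2 (Sum.elim (η • (A *ᵥ y)) (-(η • (Aᵀ *ᵥ x)))) := by
  simp [skewOperator, toLpLin_toLp, fromBlocks_mulVec, smul_mulVec, neg_mulVec]

lemma inner_skewOperator_left (A : Matrix m n ℝ) (η : ℝ) (u v : EuclideanSpace ℝ (m ⊕ n)) :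
    inner ℝ (skewOperator A η u) v = -inner ℝ u (skewOperator A η v) := by
  obtain ⟨x, y, rfl⟩ := exists_eq_toLp_sumElim u
  obtain ⟨x', y', rfl⟩ := exists_eq_toLp_sumElim v
  simp only [skewOperator_toLp, inner_toLp_sumElim, smul_dotProduct, dotProduct_smul,
    neg_dotProduct, dotProduct_neg, smul_eq_mul]
  rw [dotProduct_mulVec x, ← mulVec_transpose, dotProduct_mulVec y, ← mulVec_transpose,
    transpose_transpose]
  ring

lemma norm_sq_skewOperator_le {A : Matrix m n ℝ} {η μ : ℝ} (hμ0 : 0 ≤ μ)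
    (hμ : ∀ a ∈ spectrum ℝ (A * Aᵀ), a ≤ μ) (u : EuclideanSpace ℝ (m ⊕ n)) :
    ‖skewOperator A η u‖ ^ 2 ≤ η ^ 2 * μ * ‖u‖ ^ 2 := by
  obtain ⟨x, y, rfl⟩ := exists_eq_toLp_sumElim u
  have h1 := dotProduct_transpose_mulVec_self_le hμ x
  have h2 := dotProduct_mulVec_self_le hμ0 (dotProduct_transpose_mulVec_self_le hμ) y
  simp only [← real_inner_self_eq_norm_sq, skewOperator_toLp, inner_toLp_sumElim,
    smul_dotProduct, dotProduct_smul, neg_dotProduct, dotProduct_neg, smul_eq_mul]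
  nlinarith [mul_le_mul_of_nonneg_left (add_le_add h1 h2) (sq_nonneg η)]

lemma skewOperator_toLp_eq_zero_iff {A : Matrix m n ℝ} {η : ℝ} (hη : η ≠ 0)
    {x : m → ℝ} {y : n → ℝ} :
    skewOperator A η (WithLp.toLp 2 (Sum.elim x y)) = 0 ↔ Aᵀ *ᵥ x = 0 ∧ A *ᵥ y = 0 := by
  rw [skewOperator_toLp]
  constructor
  · intro h
    have h' := congrArg WithLp.ofLp h
    have hl : η • (A *ᵥ y) = 0 := funext fun i => congrFun h' (.inl i)
    have hr : -(η • (Aᵀ *ᵥ x)) = 0 := funext fun j => congrFun h' (.inr j)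
    rw [neg_eq_zero] at hr
    exact ⟨(smul_eq_zero.1 hr).resolve_left hη, (smul_eq_zero.1 hl).resolve_left hη⟩
  · rintro ⟨h1, h2⟩
    ext (i | j) <;> simp [h1, h2]

end SkewOperator

/-- **Theorem (zero-sum OGDA convergence).**
For a nonzero matrix `A` and step size `0 < η < 1/√(3 μ_max)` (`μ_max` the largest
eigenvalue of `AAᵀ`), the OGDA iterates for the zero-sum game `xᵀAy`, started from an
arbitrary initialization `(x₀, y₀, x₋₁, y₋₁)` (here `x 0 = x₀`, `xm1 = x₋₁`, etc.),
converge; the limit `x_∞` is the orthogonal projection of `x₀` onto `Ker Aᵀ` and `y_∞`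
is the orthogonal projection of `y₀` onto `Ker A`; in particular the limit is a Nash
equilibrium (`Aᵀ x_∞ = 0` and `A y_∞ = 0`). -/
theorem ogda_zero_sum_convergence
    {n p : ℕ} (A : Matrix (Fin n) (Fin p) ℝ) (hA : A ≠ 0)
    (μmax : ℝ) (hμmax : IsGreatest (spectrum ℝ (A * Aᵀ)) μmax)
    (η : ℝ) (hη0 : 0 < η) (hη1 : η < 1 / Real.sqrt (3 * μmax))
    (x : ℕ → Fin n → ℝ) (y : ℕ → Fin p → ℝ)
    (xm1 : Fin n → ℝ) (ym1 : Fin p → ℝ)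
    (hx1 : x 1 = x 0 + (2 * η) • (A *ᵥ y 0) - η • (A *ᵥ ym1))
    (hy1 : y 1 = y 0 - (2 * η) • (Aᵀ *ᵥ x 0) + η • (Aᵀ *ᵥ xm1))
    (hx : ∀ t, x (t + 2) = x (t + 1) + (2 * η) • (A *ᵥ y (t + 1)) - η • (A *ᵥ y t))
    (hy : ∀ t, y (t + 2) = y (t + 1) - (2 * η) • (Aᵀ *ᵥ x (t + 1)) + η • (Aᵀ *ᵥ x t)) :
    ∃ (xinf : Fin n → ℝ) (yinf : Fin p → ℝ),
      Tendsto (fun t => (x t, y t)) atTop (nhds (xinf, yinf)) ∧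
      Aᵀ *ᵥ xinf = 0 ∧ A *ᵥ yinf = 0 ∧
      (∀ x' : Fin n → ℝ, Aᵀ *ᵥ x' = 0 → (x 0 - xinf) ⬝ᵥ x' = 0) ∧
      (∀ y' : Fin p → ℝ, A *ᵥ y' = 0 → (y 0 - yinf) ⬝ᵥ y' = 0) := by
  have hμ : 0 < μmax := by
    by_contra! h
    rw [Real.sqrt_eq_zero_of_nonpos (by linarith), div_zero] at hη1
    linarith
  have hκ : 3 * (η ^ 2 * μmax) < 1 := by
    have hs : 0 < Real.sqrt (3 * μmax) := Real.sqrt_pos.2 (by positivity)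
    have h1 : η * Real.sqrt (3 * μmax) < 1 := (lt_div_iff₀ hs).1 hη1
    have h2 := Real.sq_sqrt (show 0 ≤ 3 * μmax by positivity)
    have h3 : (η * Real.sqrt (3 * μmax)) ^ 2 < 1 :=
      pow_lt_one₀ (by positivity) h1 two_ne_zero
    rw [mul_pow, h2] at h3
    linarith
  let z : ℕ → EuclideanSpace ℝ (Fin n ⊕ Fin p) := fun t => WithLp.toLp 2 (Sum.elim (x t) (y t))
  have hz0 : z 1 - z 0 ∈ (skewOperator A η).range := by
    refine ⟨(2 : ℝ) • z 0 - WithLp.toLp 2 (Sum.elim xm1 ym1), ?_⟩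
    rw [map_sub, map_smul, skewOperator_toLp, skewOperator_toLp]
    ext (i | j) <;> simp [z, hx1, hy1] <;> ring
  have hz : ∀ t, z (t + 2) =
      z (t + 1) + (2 : ℝ) • skewOperator A η (z (t + 1)) - skewOperator A η (z t) := by
    intro t
    rw [skewOperator_toLp, skewOperator_toLp]
    ext (i | j) <;> simp [z, hx, hy] <;> ring
  have hlim := tendsto_ogda_starProjection_ker (inner_skewOperator_left A η) hκ
    (norm_sq_skewOperator_le hμ.le fun a ha => hμmax.2 ha) hz0 hz
  obtain ⟨xinf, yinf, hinf⟩ :=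
    exists_eq_toLp_sumElim ((skewOperator A η).ker.starProjection (z 0))
  have hker := LinearMap.mem_ker.1
    (Submodule.starProjection_apply_mem (skewOperator A η).ker (z 0))
  have horth := Submodule.sub_starProjection_mem_orthogonal (K := (skewOperator A η).ker) (z 0)
  rw [hinf] at hlim hker horth
  rw [skewOperator_toLp_eq_zero_iff hη0.ne'] at hker
  have hdot : ∀ (x' : Fin n → ℝ) (y' : Fin p → ℝ), Aᵀ *ᵥ x' = 0 → A *ᵥ y' = 0 →
      (x 0 - xinf) ⬝ᵥ x' + (y 0 - yinf) ⬝ᵥ y' = 0 := by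
    intro x' y' hx' hy'
    have h := horth (WithLp.toLp 2 (Sum.elim x' y'))
      ((skewOperator_toLp_eq_zero_iff hη0.ne').2 ⟨hx', hy'⟩)
    rw [inner_sub_right, inner_toLp_sumElim, inner_toLp_sumElim] at h
    rw [sub_dotProduct, sub_dotProduct, dotProduct_comm (x 0), dotProduct_comm (y 0),
      dotProduct_comm xinf, dotProduct_comm yinf]
    linarith
  have hcoord := tendsto_pi_nhds.1 (((PiLp.continuous_ofLp 2 _).tendsto _).comp hlim)
  refine ⟨xinf, yinf, ?_, hker.1, hker.2, fun x' hx' => ?_, fun y' hy' => ?_⟩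
  · exact (tendsto_pi_nhds.2 fun i => hcoord (.inl i)).prodMk_nhds
      (tendsto_pi_nhds.2 fun j => hcoord (.inr j))
  · simpa using hdot x' 0 hx' (mulVec_zero _)
  · simpa using hdot 0 y' (mulVec_zero _) hy'

end
end

section
/- Let A be a nonzero real n×p matrix and let μ_max be the largest eigenvalue of AAᵀ. If η > 1/√(3·μ_max), then there exists an initialization (x₀, y₀, x₋₁, y₋₁) ∈ ℝⁿ×ℝᵖ×ℝⁿ×ℝᵖ such that the OGDA sequence (x_t, y_t) for the zero-sum game xᵀAy with step η does not converge. -/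
open Matrix Filter

noncomputable section

/-- The largest eigenvalue of `A * Aᵀ` is positive when `A ≠ 0`, and its square root is a singular
value of `A` with a pair of nonzero singular vectors. -/
theorem exists_singular_pair_of_isGreatest {m n : Type*} [Fintype m] [DecidableEq m] [Fintype n]
    {A : Matrix m n ℝ} (hA : A ≠ 0) {μ : ℝ} (hμ : IsGreatest (spectrum ℝ (A * Aᵀ)) μ) :
    0 < μ ∧ ∃ (u : m → ℝ) (v : n → ℝ), u ≠ 0 ∧ v ≠ 0 ∧
      A *ᵥ v = √μ • u ∧ Aᵀ *ᵥ u = √μ • v := by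
  have hpsd : (A * Aᵀ).PosSemidef := by
    simpa using posSemidef_self_mul_conjTranspose A
  have hherm := hpsd.isHermitian
  have hpos : 0 < μ := by
    by_contra! hle
    have hzero : A * Aᵀ = 0 := by
      refine hherm.eigenvalues_eq_zero_iff.mp (funext fun i => ?_)
      exact le_antisymm ((hμ.2 (hherm.eigenvalues_mem_spectrum_real i)).trans hle)
        (hpsd.eigenvalues_nonneg i)
    exact hA (self_mul_conjTranspose_eq_zero.mp (by simpa using hzero))
  obtain ⟨i, hi⟩ := hherm.spectrum_real_eq_range_eigenvalues ▸ hμ.1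
  have hs : √μ ≠ 0 := (Real.sqrt_pos.mpr hpos).ne'
  set u : m → ℝ := ⇑(hherm.eigenvectorBasis i) with hu
  have hu0 : u ≠ 0 := fun h =>
    hherm.eigenvectorBasis.orthonormal.ne_zero i (PiLp.ext fun j => congrFun h j)
  have hAu : A *ᵥ ((√μ)⁻¹ • (Aᵀ *ᵥ u)) = √μ • u := by
    rw [mulVec_smul, mulVec_mulVec, hu, hherm.mulVec_eigenvectorBasis, hi, smul_smul]
    congr 1
    rw [inv_mul_eq_iff_eq_mul₀ hs, Real.mul_self_sqrt hpos.le]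
  refine ⟨hpos, u, (√μ)⁻¹ • (Aᵀ *ᵥ u), hu0, fun h => ?_, hAu, ?_⟩
  · rw [h, mulVec_zero] at hAu
    exact smul_ne_zero hs hu0 hAu.symm
  · rw [smul_inv_smul₀ hs]

/-- For `c > 1 / √3`, the characteristic equation of the scalar OGDA recursion has a root outside
the closed unit disc. -/
theorem exists_one_lt_norm_ogda_root {c : ℝ} (hc : 0 < c) (hc3 : 1 < 3 * c ^ 2) :
    ∃ z : ℂ, 1 < ‖z‖ ∧ z ^ 2 = z - 2 * c * Complex.I * z + c * Complex.I := by
  have hd : √(4 * c ^ 2 - 1) ^ 2 = 4 * c ^ 2 - 1 := Real.sq_sqrt (by linarith)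
  have hd0 := Real.sqrt_nonneg (4 * c ^ 2 - 1)
  set d := √(4 * c ^ 2 - 1)
  refine ⟨⟨1 / 2, -(2 * c + d) / 2⟩, ?_, ?_⟩
  · have hdc : c < 2 * d := by nlinarith
    have hcd : 0 < c * (2 * d - c) := mul_pos hc (by linarith)
    rw [← one_lt_sq_iff₀ (norm_nonneg _), ← Complex.normSq_eq_norm_sq, Complex.normSq_mk]
    nlinarith
  · apply Complex.ext <;> simp [pow_two] <;> nlinarith

/-- If the real and imaginary parts of `z ^ (t + 1)` drive two nonzero directions and `‖z‖ > 1`,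
the resulting sequence of pairs does not converge. -/
theorem not_tendsto_re_pow_smul_im_pow_smul {ι κ : Type*} {z : ℂ} (hz : 1 < ‖z‖)
    {u : ι → ℝ} {v : κ → ℝ} (hu : u ≠ 0) (hv : v ≠ 0) (L : (ι → ℝ) × (κ → ℝ)) :
    ¬ Tendsto (fun t : ℕ => ((z ^ (t + 1)).re • u, (z ^ (t + 1)).im • v)) atTop (nhds L) := by
  intro h
  obtain ⟨i, hi⟩ := Function.ne_iff.mp hu
  obtain ⟨j, hj⟩ := Function.ne_iff.mp hv
  have hre : Tendsto (fun t : ℕ => (z ^ (t + 1)).re) atTop (nhds (L.1 i / u i)) := by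
    simpa [mul_div_cancel_right₀ _ hi] using! ((tendsto_pi_nhds.mp h.fst_nhds i).div_const (u i))
  have him : Tendsto (fun t : ℕ => (z ^ (t + 1)).im) atTop (nhds (L.2 j / v j)) := by
    simpa [mul_div_cancel_right₀ _ hj] using! ((tendsto_pi_nhds.mp h.snd_nhds j).div_const (v j))
  have hsq := (hre.pow 2).add (him.pow 2)
  refine not_tendsto_nhds_of_tendsto_atTop ?_ _ hsq
  have hgrow : Tendsto (fun t : ℕ => (‖z‖ ^ 2) ^ (t + 1)) atTop atTop :=
    (tendsto_pow_atTop_atTop_of_one_lt (one_lt_pow₀ hz two_ne_zero)).comp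
      (tendsto_add_atTop_nat 1)
  refine hgrow.congr fun t => ?_
  rw [pow_right_comm, ← norm_pow, ← Complex.normSq_eq_norm_sq, Complex.normSq_apply]
  ring

/-- **Theorem (divergence of zero-sum OGDA for large step sizes).**
If `A ≠ 0` and `η > 1/√(3 μ_max)` (`μ_max` the largest eigenvalue of `AAᵀ`), then there
is an initialization `(x₀, y₀, x₋₁, y₋₁)` for which the OGDA iterates of the zero-sum
game `xᵀAy` do not converge. -/
theorem ogda_zero_sum_divergence
    {n p : ℕ} (A : Matrix (Fin n) (Fin p) ℝ) (hA : A ≠ 0)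
    (μmax : ℝ) (hμmax : IsGreatest (spectrum ℝ (A * Aᵀ)) μmax)
    (η : ℝ) (hη : η > 1 / Real.sqrt (3 * μmax)) :
    ∃ (x : ℕ → Fin n → ℝ) (y : ℕ → Fin p → ℝ) (xm1 : Fin n → ℝ) (ym1 : Fin p → ℝ),
      x 1 = x 0 + (2 * η) • (A *ᵥ y 0) - η • (A *ᵥ ym1) ∧
      y 1 = y 0 - (2 * η) • (Aᵀ *ᵥ x 0) + η • (Aᵀ *ᵥ xm1) ∧
      (∀ t, x (t + 2) = x (t + 1) + (2 * η) • (A *ᵥ y (t + 1)) - η • (A *ᵥ y t)) ∧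
      (∀ t, y (t + 2) = y (t + 1) - (2 * η) • (Aᵀ *ᵥ x (t + 1)) + η • (Aᵀ *ᵥ x t)) ∧
      ¬ ∃ L : (Fin n → ℝ) × (Fin p → ℝ), Tendsto (fun t => (x t, y t)) atTop (nhds L) := by
  obtain ⟨hμ, u, v, hu, hv, hAv, hAu⟩ := exists_singular_pair_of_isGreatest hA hμmax
  have hs : 0 < √μmax := Real.sqrt_pos.mpr hμ
  have hη0 : 0 < η := lt_of_le_of_lt (by positivity) hη
  have hc : 1 < 3 * (η * √μmax) ^ 2 := by
    have h1 : 1 < η * √(3 * μmax) := (div_lt_iff₀ (Real.sqrt_pos.mpr (by positivity))).mp hη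
    have h2 := one_lt_pow₀ h1 two_ne_zero
    rw [mul_pow, Real.sq_sqrt (by positivity)] at h2
    rw [mul_pow, Real.sq_sqrt hμ.le]
    linarith
  obtain ⟨z, hz, hroot⟩ := exists_one_lt_norm_ogda_root (mul_pos hη0 hs) hc
  have hrec (k : ℕ) : z ^ (k + 2) = z ^ (k + 1)
      - ((2 * (η * √μmax) : ℝ) : ℂ) * (Complex.I * z ^ (k + 1))
      + ((η * √μmax : ℝ) : ℂ) * (Complex.I * z ^ k) := by
    push_cast at hroot ⊢
    rw [pow_add, hroot]
    ring
  have hre (k : ℕ) : (z ^ (k + 2)).re • u = (z ^ (k + 1)).re • u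
      + (2 * η) • (A *ᵥ ((z ^ (k + 1)).im • v)) - η • (A *ᵥ ((z ^ k).im • v)) := by
    have h := congrArg Complex.re (hrec k)
    simp only [Complex.add_re, Complex.sub_re, Complex.re_ofReal_mul, Complex.I_mul_re] at h
    rw [h, mulVec_smul, mulVec_smul, hAv]
    module
  have him (k : ℕ) : (z ^ (k + 2)).im • v = (z ^ (k + 1)).im • v
      - (2 * η) • (Aᵀ *ᵥ ((z ^ (k + 1)).re • u)) + η • (Aᵀ *ᵥ ((z ^ k).re • u)) := by
    have h := congrArg Complex.im (hrec k)
    simp only [Complex.add_im, Complex.sub_im, Complex.im_ofReal_mul, Complex.I_mul_im] at h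
    rw [h, mulVec_smul, mulVec_smul, hAu]
    module
  exact ⟨fun t => (z ^ (t + 1)).re • u, fun t => (z ^ (t + 1)).im • v,
    (z ^ 0).re • u, (z ^ 0).im • v, hre 0, him 0, fun t => hre (t + 1), fun t => him (t + 1),
    fun ⟨L, hL⟩ => not_tendsto_re_pow_smul_im_pow_smul hz hu hv L hL⟩

end
end

section
/- Let A be a nonzero real n×p matrix, μ_max the largest eigenvalue of AAᵀ, μ_min the smallest positive eigenvalue of AAᵀ, and let 0 < η < 1/(2√μ_max). Let (x_t, y_t) be the OGDA sequence for the zero-sum game xᵀAy with step η and initialization (x₀, y₀, x₋₁, y₋₁), and let (x_∞, y_∞) be its limit (the orthogonal projections of x₀ onto Ker(Aᵀ) and of y₀ onto Ker(A)). Let D be the Euclidean distance from (x₀, y₀, x₋₁, y₋₁) to the set {(x, y, x, y) : Aᵀx = 0, Ay = 0}. Then for all t ≥ 0, ‖(x_t, y_t) − (x_∞, y_∞)‖ ≤ C · D · λ_max^t, where λ_max = √(½(1 + √(1 − 4η²μ_min))) and C = √( 2 / (1 − √((1 + 5η²μ_max)/(2 + η²μ_max))) ). -/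
open Matrix Filter

noncomputable section

lemma sqnorm_nonneg {n : ℕ} (v : Fin n → ℝ) : 0 ≤ sqnorm v :=
  Finset.sum_nonneg fun _ _ => sq_nonneg _

lemma sq_le_sqnorm {n : ℕ} (v : Fin n → ℝ) (i : Fin n) : (v i) ^ 2 ≤ sqnorm v :=
  Finset.single_le_sum (f := fun i => (v i) ^ 2) (fun _ _ => sq_nonneg _) (Finset.mem_univ i)

/-- Every vector has an orthogonal projection on the kernel of a real matrix. -/
lemma exists_orthogonal_projection_ker {m n : ℕ} (B : Matrix (Fin m) (Fin n) ℝ)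
    (v : Fin n → ℝ) :
    ∃ q : Fin n → ℝ, B *ᵥ q = 0 ∧ ∀ w, B *ᵥ w = 0 → (v - q) ⬝ᵥ w = 0 := by
  let K : Submodule ℝ (EuclideanSpace ℝ (Fin n)) := LinearMap.ker (Matrix.toEuclideanLin B)
  have mem_K : ∀ w : EuclideanSpace ℝ (Fin n), w ∈ K ↔ B *ᵥ w.ofLp = 0 := by
    intro w
    simp [K, LinearMap.mem_ker, Matrix.toLpLin_apply]
  refine ⟨(K.starProjection (WithLp.toLp 2 v)).ofLp,
    (mem_K _).1 (K.starProjection_apply_mem _), fun w hw => ?_⟩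
  have h := K.starProjection_inner_eq_zero (WithLp.toLp 2 v) (WithLp.toLp 2 w) ((mem_K _).2 hw)
  rw [EuclideanSpace.inner_eq_star_dotProduct] at h
  rw [dotProduct_comm]
  simpa using h

/-- The spectral decomposition of the symmetric matrix with off-diagonal blocks `A` and `Aᵀ`,
written out on the two blocks. -/
lemma exists_singular_parseval_system {n p : ℕ} (A : Matrix (Fin n) (Fin p) ℝ) :
    ∃ (θ : Fin n ⊕ Fin p → ℝ) (u : Fin n ⊕ Fin p → Fin n → ℝ) (v : Fin n ⊕ Fin p → Fin p → ℝ),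
      (∀ k, A *ᵥ v k = θ k • u k) ∧ (∀ k, Aᵀ *ᵥ u k = θ k • v k) ∧
      (∀ k, u k ≠ 0 ∨ v k ≠ 0) ∧
      (∀ x, ∑ k, (u k ⬝ᵥ x) ^ 2 = sqnorm x) ∧ (∀ y, ∑ k, (v k ⬝ᵥ y) ^ 2 = sqnorm y) := by
  have hH : (Matrix.fromBlocks 0 A Aᵀ 0).IsHermitian := by
    rw [Matrix.IsHermitian, Matrix.fromBlocks_conjTranspose]; simp
  let b := hH.eigenvectorBasis
  have eig : ∀ k, (Matrix.fromBlocks 0 A Aᵀ 0) *ᵥ (b k).ofLp = hH.eigenvalues k • (b k).ofLp :=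
    fun k => hH.mulVec_eigenvectorBasis k
  have parseval : ∀ w : Fin n ⊕ Fin p → ℝ,
      ∑ k, ((b k).ofLp ⬝ᵥ w) ^ 2 = ∑ i, (w i) ^ 2 := by
    intro w
    have h := b.sum_sq_norm_inner_right (WithLp.toLp 2 w)
    rw [EuclideanSpace.real_norm_sq_eq] at h
    rw [← h]
    refine Finset.sum_congr rfl fun k _ => ?_
    rw [EuclideanSpace.inner_eq_star_dotProduct, Real.norm_eq_abs, sq_abs, dotProduct_comm]
    simp
  refine ⟨hH.eigenvalues, fun k i => b k (Sum.inl i), fun k j => b k (Sum.inr j),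
    fun k => ?_, fun k => ?_, fun k => ?_, fun x => ?_, fun y => ?_⟩
  · ext i
    have h := congrFun (eig k) (Sum.inl i)
    simpa [Matrix.mulVec, dotProduct, Fintype.sum_sum_type] using h
  · ext j
    have h := congrFun (eig k) (Sum.inr j)
    simpa [Matrix.mulVec, dotProduct, Fintype.sum_sum_type] using h
  · by_contra! h
    refine b.orthonormal.ne_zero k ?_
    ext (i | j)
    · exact congrFun h.1 i
    · exact congrFun h.2 j
  · simpa [dotProduct, Fintype.sum_sum_type, sqnorm] using parseval (Sum.elim x 0)
  · simpa [dotProduct, Fintype.sum_sum_type, sqnorm] using parseval (Sum.elim 0 y)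

lemma mem_spectrum_of_mulVec_eq_smul {n : ℕ} {M : Matrix (Fin n) (Fin n) ℝ} {μ : ℝ}
    {u : Fin n → ℝ} (hu : u ≠ 0) (h : M *ᵥ u = μ • u) : μ ∈ spectrum ℝ M := by
  rw [spectrum.mem_iff]
  intro hunit
  refine hu (Matrix.mulVec_injective_of_isUnit hunit ?_)
  rw [Matrix.sub_mulVec, h, Matrix.mulVec_zero, Algebra.algebraMap_eq_smul_one,
    Matrix.smul_mulVec, Matrix.one_mulVec, sub_self]

/-- Cauchy–Schwarz and AM-GM for the cross term of a sum of two vectors of squared norms `P` and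
`Q` with coefficients `a` and `b`, where `G` is their inner product and `c` bounds the cosine of
their angle. -/
lemma abs_two_mul_re_le {a b G : ℂ} {P Q c : ℝ} (hP : 0 ≤ P) (hQ : 0 ≤ Q) (hc : 0 ≤ c)
    (hG : ‖G‖ ^ 2 ≤ c ^ 2 * (P * Q)) :
    |2 * (a * star b * G).re| ≤ c * (‖a‖ ^ 2 * P + ‖b‖ ^ 2 * Q) := by
  have h1 : |(a * star b * G).re| ≤ ‖a‖ * ‖b‖ * ‖G‖ := by
    refine (Complex.abs_re_le_norm _).trans ?_
    rw [norm_mul, norm_mul, norm_star]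
  have h2 : ‖G‖ ≤ c * (√P * √Q) := by
    refine (sq_le_sq₀ (norm_nonneg _) (by positivity)).1 ?_
    rw [mul_pow, mul_pow, Real.sq_sqrt hP, Real.sq_sqrt hQ]
    exact hG
  have h3 : ‖a‖ * ‖b‖ * ‖G‖ ≤ ‖a‖ * ‖b‖ * (c * (√P * √Q)) := by gcongr
  have h4 : 0 ≤ c * (‖a‖ * √P - ‖b‖ * √Q) ^ 2 := by positivity
  rw [abs_mul, abs_two]
  have h5 : c * (‖a‖ * √P - ‖b‖ * √Q) ^ 2 =
      c * (‖a‖ ^ 2 * P + ‖b‖ ^ 2 * Q) - 2 * (‖a‖ * ‖b‖ * (c * (√P * √Q))) := by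
    rw [← Real.sq_sqrt hP, ← Real.sq_sqrt hQ]
    simp only [Real.sqrt_sq, Real.sqrt_nonneg]
    ring
  linarith

/-- Exponential bound for the scalar OGDA recurrence, whose characteristic roots are
`(1 ± √(1 - 4s²))/2 - i s`. -/
lemma normSq_ogda_scalar_le {s c : ℝ} (hs : 4 * s ^ 2 < 1) (hc : c < 1) (hc0 : 0 ≤ c)
    (hcs : (1 + 5 * s ^ 2) ≤ c ^ 2 * (2 + s ^ 2)) (w : ℕ → ℂ)
    (hw : ∀ t, w (t + 2) = (1 - 2 * Complex.I * s) * w (t + 1) + Complex.I * s * w t) (t : ℕ) :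
    ‖w (t + 1)‖ ^ 2 ≤
      2 / (1 - c) * ((1 + √(1 - 4 * s ^ 2)) / 2) ^ t * (‖w 0‖ ^ 2 + ‖w 1‖ ^ 2) := by
  set r := √(1 - 4 * s ^ 2) with hr
  have hr0 : 0 < r := Real.sqrt_pos.2 (by linarith)
  have hr2 : r ^ 2 = 1 - 4 * s ^ 2 := Real.sq_sqrt (by linarith)
  have hrC : (r : ℂ) ^ 2 = 1 - 4 * (s : ℂ) ^ 2 := by exact_mod_cast hr2
  have hrne : (r : ℂ) ≠ 0 := by exact_mod_cast hr0.ne'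
  have hr1 : r ≤ 1 := by nlinarith [sq_nonneg s]
  set l₁ : ℂ := ⟨(1 + r) / 2, -s⟩ with hl₁
  set l₂ : ℂ := ⟨(1 - r) / 2, -s⟩ with hl₂
  have e₁ : l₁ = (1 + r) / 2 - Complex.I * s := by apply Complex.ext <;> simp [hl₁]
  have e₂ : l₂ = (1 - r) / 2 - Complex.I * s := by apply Complex.ext <;> simp [hl₂]
  have n₁ : ‖l₁‖ ^ 2 = (1 + r) / 2 := by
    rw [← Complex.normSq_eq_norm_sq, Complex.normSq_mk]; nlinarith
  have n₂ : ‖l₂‖ ^ 2 = (1 - r) / 2 := by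
    rw [← Complex.normSq_eq_norm_sq, Complex.normSq_mk]; nlinarith
  have q₁ : l₁ ^ 2 = (1 - 2 * Complex.I * s) * l₁ + Complex.I * s := by
    rw [e₁]; linear_combination hrC / 4 - (s : ℂ) ^ 2 * Complex.I_sq
  have q₂ : l₂ ^ 2 = (1 - 2 * Complex.I * s) * l₂ + Complex.I * s := by
    rw [e₂]; linear_combination hrC / 4 - (s : ℂ) ^ 2 * Complex.I_sq
  set α : ℂ := (w 1 - l₂ * w 0) / r with hα
  set β : ℂ := (l₁ * w 0 - w 1) / r with hβ
  have hdiff : l₁ - l₂ = r := by rw [e₁, e₂]; ring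
  have hsol : ∀ t, w t = α * l₁ ^ t + β * l₂ ^ t := by
    intro t
    induction t using Nat.twoStepInduction with
    | zero =>
      rw [hα, hβ]; field_simp; linear_combination (-w 0) * hdiff
    | one =>
      rw [hα, hβ]; field_simp; linear_combination (-w 1) * hdiff
    | more t ih₁ ih₂ =>
      rw [hw, ih₁, ih₂]
      linear_combination -(α * l₁ ^ t) * q₁ - (β * l₂ ^ t) * q₂
  have hG : ‖1 + l₁ * star l₂‖ ^ 2 ≤ c ^ 2 * ((1 + ‖l₁‖ ^ 2) * (1 + ‖l₂‖ ^ 2)) := by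
    have h1 : 1 + l₁ * star l₂ = ⟨1 + 2 * s ^ 2, s * r⟩ := by
      apply Complex.ext
      · simp [hl₁, hl₂]; nlinarith
      · simp [hl₁, hl₂]; ring
    rw [n₁, n₂, h1, ← Complex.normSq_eq_norm_sq, Complex.normSq_mk]
    have h2 : (1 + (1 + r) / 2) * (1 + (1 - r) / 2) = 2 + s ^ 2 := by nlinarith
    have h3 : (1 + 2 * s ^ 2) * (1 + 2 * s ^ 2) + s * r * (s * r) = 1 + 5 * s ^ 2 := by
      linear_combination s ^ 2 * hr2
    rw [h2, h3]
    exact hcs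
  have expand : ∀ a b : ℂ, ‖a + b‖ ^ 2 + ‖a * l₁ + b * l₂‖ ^ 2 =
      ‖a‖ ^ 2 * (1 + ‖l₁‖ ^ 2) + ‖b‖ ^ 2 * (1 + ‖l₂‖ ^ 2) +
        2 * (a * star b * (1 + l₁ * star l₂)).re := by
    intro a b
    simp only [← Complex.normSq_eq_norm_sq, Complex.normSq_apply]
    simp
    ring
  have cross := fun a b : ℂ => abs_le.1 (abs_two_mul_re_le (a := a) (b := b)
    (P := 1 + ‖l₁‖ ^ 2) (Q := 1 + ‖l₂‖ ^ 2) (by positivity) (by positivity) hc0 hG)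
  set E : ℝ := ‖α‖ ^ 2 * (1 + ‖l₁‖ ^ 2) + ‖β‖ ^ 2 * (1 + ‖l₂‖ ^ 2) with hE
  have hE0 : 0 ≤ E := by positivity
  have lower : (1 - c) * E ≤ ‖w 0‖ ^ 2 + ‖w 1‖ ^ 2 := by
    have h0 : w 0 = α + β := by simpa using hsol 0
    have h1 : w 1 = α * l₁ + β * l₂ := by simpa using hsol 1
    rw [h0, h1, expand]
    linarith [(cross α β).1]
  have upper : ‖w (t + 1)‖ ^ 2 ≤ (1 + c) * (((1 + r) / 2) ^ t * E) := by
    have h0 : w (t + 1) = α * l₁ ^ t * l₁ + β * l₂ ^ t * l₂ := by rw [hsol]; ring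
    have h1 := expand (α * l₁ ^ t) (β * l₂ ^ t)
    have h2 := (cross (α * l₁ ^ t) (β * l₂ ^ t)).2
    have h3 : ‖α * l₁ ^ t‖ ^ 2 = ‖α‖ ^ 2 * ((1 + r) / 2) ^ t := by
      rw [norm_mul, norm_pow, mul_pow, ← pow_mul, mul_comm t 2, pow_mul, n₁]
    have h4 : ‖β * l₂ ^ t‖ ^ 2 ≤ ‖β‖ ^ 2 * ((1 + r) / 2) ^ t := by
      rw [norm_mul, norm_pow, mul_pow, ← pow_mul, mul_comm t 2, pow_mul, n₂]
      gcongr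
      linarith
    have h5 : ‖α * l₁ ^ t‖ ^ 2 * (1 + ‖l₁‖ ^ 2) + ‖β * l₂ ^ t‖ ^ 2 * (1 + ‖l₂‖ ^ 2) ≤
        ((1 + r) / 2) ^ t * E := by
      have := mul_le_mul_of_nonneg_right h4 (show 0 ≤ 1 + ‖l₂‖ ^ 2 by positivity)
      rw [h3, hE]
      linarith
    have h6 := mul_le_mul_of_nonneg_left h5 (show 0 ≤ 1 + c by linarith)
    rw [h0]
    linarith [sq_nonneg ‖α * l₁ ^ t + β * l₂ ^ t‖]
  have hc1 : 0 < 1 - c := by linarith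
  calc ‖w (t + 1)‖ ^ 2 ≤ (1 + c) * (((1 + r) / 2) ^ t * E) := upper
    _ ≤ 2 * (((1 + r) / 2) ^ t * E) := by gcongr; linarith
    _ = 2 / (1 - c) * ((1 + r) / 2) ^ t * ((1 - c) * E) := by field_simp
    _ ≤ _ := by gcongr

/-- Exponential bound for a zero-sum OGDA sequence, indexed so that `X 0, Y 0` and `X 1, Y 1` are
the initial points, when `X 1` and `Y 1` are orthogonal to the stationary points. -/
lemma ogda_sqnorm_le {n p : ℕ} (A : Matrix (Fin n) (Fin p) ℝ) {η c ρ : ℝ}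
    (hc : c < 1) (hc0 : 0 ≤ c) (hρ : 0 ≤ ρ)
    (hsmall : ∀ μ ∈ spectrum ℝ (A * Aᵀ), 0 < μ → 4 * (η ^ 2 * μ) < 1)
    (hangle : ∀ μ ∈ spectrum ℝ (A * Aᵀ), 0 < μ → 1 + 5 * (η ^ 2 * μ) ≤ c ^ 2 * (2 + η ^ 2 * μ))
    (hrate : ∀ μ ∈ spectrum ℝ (A * Aᵀ), 0 < μ → (1 + √(1 - 4 * (η ^ 2 * μ))) / 2 ≤ ρ)
    (X : ℕ → Fin n → ℝ) (Y : ℕ → Fin p → ℝ)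
    (hX : ∀ t, X (t + 2) = X (t + 1) + (2 * η) • (A *ᵥ Y (t + 1)) - η • (A *ᵥ Y t))
    (hY : ∀ t, Y (t + 2) = Y (t + 1) - (2 * η) • (Aᵀ *ᵥ X (t + 1)) + η • (Aᵀ *ᵥ X t))
    (hX1 : ∀ x', Aᵀ *ᵥ x' = 0 → X 1 ⬝ᵥ x' = 0) (hY1 : ∀ y', A *ᵥ y' = 0 → Y 1 ⬝ᵥ y' = 0)
    {xs : Fin n → ℝ} {ys : Fin p → ℝ} (hxs : Aᵀ *ᵥ xs = 0) (hys : A *ᵥ ys = 0) (t : ℕ) :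
    sqnorm (X (t + 1)) + sqnorm (Y (t + 1)) ≤ 2 / (1 - c) * ρ ^ t *
      (sqnorm (X 1 - xs) + sqnorm (Y 1 - ys) + sqnorm (X 0 - xs) + sqnorm (Y 0 - ys)) := by
  obtain ⟨θ, u, v, hv, hu, huv, hun, hvn⟩ := exists_singular_parseval_system A
  have uA : ∀ k y, u k ⬝ᵥ (A *ᵥ y) = θ k * (v k ⬝ᵥ y) := by
    intro k y
    rw [Matrix.dotProduct_mulVec, ← Matrix.mulVec_transpose, hu, smul_dotProduct, smul_eq_mul]
  have vA : ∀ k x, v k ⬝ᵥ (Aᵀ *ᵥ x) = θ k * (u k ⬝ᵥ x) := by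
    intro k x
    rw [Matrix.dotProduct_mulVec, Matrix.vecMul_transpose, hv, smul_dotProduct, smul_eq_mul]
  have hXk : ∀ k t, u k ⬝ᵥ X (t + 2) = u k ⬝ᵥ X (t + 1) + 2 * η * (θ k * (v k ⬝ᵥ Y (t + 1)))
      - η * (θ k * (v k ⬝ᵥ Y t)) := by
    intro k t
    rw [hX, dotProduct_sub, dotProduct_add, dotProduct_smul, dotProduct_smul, uA, uA,
      smul_eq_mul, smul_eq_mul]
  have hYk : ∀ k t, v k ⬝ᵥ Y (t + 2) = v k ⬝ᵥ Y (t + 1) - 2 * η * (θ k * (u k ⬝ᵥ X (t + 1)))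
      + η * (θ k * (u k ⬝ᵥ X t)) := by
    intro k t
    rw [hY, dotProduct_add, dotProduct_sub, dotProduct_smul, dotProduct_smul, vA, vA,
      smul_eq_mul, smul_eq_mul]
  have hK : 0 ≤ 2 / (1 - c) := div_nonneg zero_le_two (by linarith)
  have key : ∀ k, (u k ⬝ᵥ X (t + 1)) ^ 2 + (v k ⬝ᵥ Y (t + 1)) ^ 2 ≤ 2 / (1 - c) * ρ ^ t *
      ((u k ⬝ᵥ (X 1 - xs)) ^ 2 + (v k ⬝ᵥ (Y 1 - ys)) ^ 2 + (u k ⬝ᵥ (X 0 - xs)) ^ 2 +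
        (v k ⬝ᵥ (Y 0 - ys)) ^ 2) := by
    intro k
    by_cases hθ : θ k = 0
    · have hzero : ∀ t, u k ⬝ᵥ X (t + 1) = 0 ∧ v k ⬝ᵥ Y (t + 1) = 0 := by
        intro t
        induction t with
        | zero =>
          rw [dotProduct_comm, dotProduct_comm (v k)]
          exact ⟨hX1 _ (by rw [hu, hθ, zero_smul]), hY1 _ (by rw [hv, hθ, zero_smul])⟩
        | succ t ih =>
          rw [hXk, hYk, ih.1, ih.2, hθ]
          simp
      rw [(hzero t).1, (hzero t).2, zero_pow two_ne_zero, add_zero]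
      exact mul_nonneg (mul_nonneg hK (pow_nonneg hρ t)) (by positivity)
    · have hxs0 : u k ⬝ᵥ xs = 0 := by
        have h := vA k xs
        rw [hxs, dotProduct_zero] at h
        exact (mul_eq_zero.1 h.symm).resolve_left hθ
      have hys0 : v k ⬝ᵥ ys = 0 := by
        have h := uA k ys
        rw [hys, dotProduct_zero] at h
        exact (mul_eq_zero.1 h.symm).resolve_left hθ
      have hune : u k ≠ 0 := by
        intro h
        have h1 := hu k
        rw [h, Matrix.mulVec_zero] at h1
        exact (huv k).elim (fun h' => h' h) fun h' =>
          h' ((smul_eq_zero.1 h1.symm).resolve_left hθ)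
      have hmem : θ k ^ 2 ∈ spectrum ℝ (A * Aᵀ) := by
        refine mem_spectrum_of_mulVec_eq_smul hune ?_
        rw [← Matrix.mulVec_mulVec, hu, Matrix.mulVec_smul, hv, smul_smul, sq]
      have hpos : 0 < θ k ^ 2 := by positivity
      have hsq : (η * θ k) ^ 2 = η ^ 2 * θ k ^ 2 := by ring
      have h := normSq_ogda_scalar_le (s := η * θ k) (by rw [hsq]; exact hsmall _ hmem hpos) hc hc0
        (by rw [hsq]; exact hangle _ hmem hpos) (fun t => ⟨u k ⬝ᵥ X t, v k ⬝ᵥ Y t⟩)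
        (fun t => by
          apply Complex.ext
          · simp [hXk]; ring
          · simp [hYk]; ring) t
      simp only [← Complex.normSq_eq_norm_sq, Complex.normSq_mk, hsq] at h
      simp only [dotProduct_sub, hxs0, hys0, sub_zero]
      calc (u k ⬝ᵥ X (t + 1)) ^ 2 + (v k ⬝ᵥ Y (t + 1)) ^ 2
          ≤ 2 / (1 - c) * ((1 + √(1 - 4 * (η ^ 2 * θ k ^ 2))) / 2) ^ t *
            ((u k ⬝ᵥ X 1) ^ 2 + (v k ⬝ᵥ Y 1) ^ 2 + (u k ⬝ᵥ X 0) ^ 2 + (v k ⬝ᵥ Y 0) ^ 2) := by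
            convert h using 1 <;> ring
        _ ≤ _ := by
            gcongr
            exact hrate _ hmem hpos
  have hsum := Finset.sum_le_sum fun k (_ : k ∈ Finset.univ) => key k
  simpa only [← Finset.mul_sum, Finset.sum_add_distrib, hun, hvn] using hsum

lemma tendsto_of_tendsto_sqnorm {n : ℕ} {z : ℕ → Fin n → ℝ} {l : Fin n → ℝ}
    (h : Tendsto (fun t => sqnorm (z t - l)) atTop (nhds 0)) : Tendsto z atTop (nhds l) := by
  refine tendsto_pi_nhds.2 fun i => ?_
  have h1 : Tendsto (fun t => (z t i - l i) ^ 2) atTop (nhds 0) :=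
    squeeze_zero (fun t => sq_nonneg _) (fun t => sq_le_sqnorm (z t - l) i) h
  have h2 := h1.sqrt
  simp only [Real.sqrt_sq_eq_abs, Real.sqrt_zero] at h2
  exact tendsto_sub_nhds_zero_iff.1 ((tendsto_zero_iff_abs_tendsto_zero _).2 h2)

/-- **Theorem (exponential convergence of zero-sum OGDA, small step size).**
For `A ≠ 0`, `μ_max` the largest and `μ_min` the smallest positive eigenvalue of `AAᵀ`,
and `0 < η < 1/(2√μ_max)`, the OGDA iterates converge to `(x_∞, y_∞)` (the orthogonal
projections of `x₀` on `Ker Aᵀ` and of `y₀` on `Ker A`) and for all `t ≥ 0`,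
`‖(x_t, y_t) − (x_∞, y_∞)‖ ≤ C · D · λ_max ^ t`, with
`λ_max = √(½(1+√(1−4η²μ_min)))`, `C = √(2/(1−√((1+5η²μ_max)/(2+η²μ_max))))`, and `D`
the Euclidean distance from the initialization to `{(x,y,x,y) : Aᵀx = 0, Ay = 0}`. -/
theorem ogda_zero_sum_exponential_rate
    {n p : ℕ} (A : Matrix (Fin n) (Fin p) ℝ) (hA : A ≠ 0)
    (μmax μmin : ℝ)
    (hμmax : IsGreatest (spectrum ℝ (A * Aᵀ)) μmax)
    (hμmin : IsLeast {μ ∈ spectrum ℝ (A * Aᵀ) | 0 < μ} μmin)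
    (η : ℝ) (hη0 : 0 < η) (hη1 : η < 1 / (2 * Real.sqrt μmax))
    (x : ℕ → Fin n → ℝ) (y : ℕ → Fin p → ℝ)
    (xm1 : Fin n → ℝ) (ym1 : Fin p → ℝ)
    (hx1 : x 1 = x 0 + (2 * η) • (A *ᵥ y 0) - η • (A *ᵥ ym1))
    (hy1 : y 1 = y 0 - (2 * η) • (Aᵀ *ᵥ x 0) + η • (Aᵀ *ᵥ xm1))
    (hx : ∀ t, x (t + 2) = x (t + 1) + (2 * η) • (A *ᵥ y (t + 1)) - η • (A *ᵥ y t))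
    (hy : ∀ t, y (t + 2) = y (t + 1) - (2 * η) • (Aᵀ *ᵥ x (t + 1)) + η • (Aᵀ *ᵥ x t))
    (D : ℝ)
    (hD : D = sInf {d : ℝ | ∃ (xs : Fin n → ℝ) (ys : Fin p → ℝ),
      Aᵀ *ᵥ xs = 0 ∧ A *ᵥ ys = 0 ∧
      d = Real.sqrt (sqnorm (x 0 - xs) + sqnorm (y 0 - ys) +
            sqnorm (xm1 - xs) + sqnorm (ym1 - ys))}) :
    ∃ (xinf : Fin n → ℝ) (yinf : Fin p → ℝ),
      Tendsto (fun t => (x t, y t)) atTop (nhds (xinf, yinf)) ∧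
      Aᵀ *ᵥ xinf = 0 ∧ A *ᵥ yinf = 0 ∧
      (∀ x' : Fin n → ℝ, Aᵀ *ᵥ x' = 0 → (x 0 - xinf) ⬝ᵥ x' = 0) ∧
      (∀ y' : Fin p → ℝ, A *ᵥ y' = 0 → (y 0 - yinf) ⬝ᵥ y' = 0) ∧
      ∀ t, Real.sqrt (sqnorm (x t - xinf) + sqnorm (y t - yinf)) ≤
        Real.sqrt (2 / (1 - Real.sqrt ((1 + 5 * η^2 * μmax) / (2 + η^2 * μmax)))) * D *
          (Real.sqrt ((1 + Real.sqrt (1 - 4 * η^2 * μmin)) / 2)) ^ t := by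
  obtain ⟨xinf, hxker, hxorth⟩ := exists_orthogonal_projection_ker Aᵀ (x 0)
  obtain ⟨yinf, hyker, hyorth⟩ := exists_orthogonal_projection_ker A (y 0)
  have hμmin0 : 0 < μmin := hμmin.1.2
  have hμmax0 : 0 < μmax := hμmin0.trans_le (hμmax.2 hμmin.1.1)
  have hη2 : 4 * (η ^ 2 * μmax) < 1 := by
    have hs : 0 < √μmax := Real.sqrt_pos.2 hμmax0
    rw [lt_div_iff₀ (by positivity)] at hη1
    have h0 : 0 ≤ η * (2 * √μmax) := by positivity
    calc 4 * (η ^ 2 * μmax) = (η * (2 * √μmax)) ^ 2 := by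
          rw [mul_pow, mul_pow, Real.sq_sqrt hμmax0.le]; ring
      _ < 1 := by nlinarith
  set m := η ^ 2 * μmax with hm
  have hm0 : 0 < m := by positivity
  have hcm : 1 + 5 * η ^ 2 * μmax = 1 + 5 * m := by rw [hm]; ring
  rw [hcm]
  set c := √((1 + 5 * m) / (2 + m)) with hc
  have hc0 : 0 ≤ c := Real.sqrt_nonneg _
  have hc2 : c ^ 2 = (1 + 5 * m) / (2 + m) := Real.sq_sqrt (by positivity)
  have hc1 : c < 1 := by
    rw [hc, Real.sqrt_lt' one_pos, one_pow, div_lt_one (by positivity)]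
    linarith
  set ρ := (1 + √(1 - 4 * η ^ 2 * μmin)) / 2 with hρ
  have hρ0 : 0 < ρ := by positivity
  have hρ1 : ρ < 1 := by
    have : √(1 - 4 * η ^ 2 * μmin) < 1 := by
      rw [Real.sqrt_lt' one_pos]
      have : 0 < 4 * η ^ 2 * μmin := by positivity
      linarith
    rw [hρ]
    linarith
  have hle : ∀ μ ∈ spectrum ℝ (A * Aᵀ), η ^ 2 * μ ≤ m := fun μ h =>
    mul_le_mul_of_nonneg_left (hμmax.2 h) (sq_nonneg η)
  obtain ⟨X, hX0, hXs⟩ : ∃ X : ℕ → Fin n → ℝ, X 0 = xm1 - xinf ∧ ∀ t, X (t + 1) = x t - xinf :=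
    ⟨fun t => Nat.casesOn t (xm1 - xinf) fun t => x t - xinf, rfl, fun _ => rfl⟩
  obtain ⟨Y, hY0, hYs⟩ : ∃ Y : ℕ → Fin p → ℝ, Y 0 = ym1 - yinf ∧ ∀ t, Y (t + 1) = y t - yinf :=
    ⟨fun t => Nat.casesOn t (ym1 - yinf) fun t => y t - yinf, rfl, fun _ => rfl⟩
  have hX1 : X 1 = x 0 - xinf := hXs 0
  have hY1 : Y 1 = y 0 - yinf := hYs 0
  have hXrec : ∀ t, X (t + 2) = X (t + 1) + (2 * η) • (A *ᵥ Y (t + 1)) - η • (A *ᵥ Y t) := by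
    rintro (_ | t)
    · rw [hXs, hXs, hYs, hY0, hx1]
      simp only [Matrix.mulVec_sub, hyker, sub_zero]
      abel
    · rw [hXs, hXs, hYs, hYs, hx]
      simp only [Matrix.mulVec_sub, hyker, sub_zero]
      abel
  have hYrec : ∀ t, Y (t + 2) = Y (t + 1) - (2 * η) • (Aᵀ *ᵥ X (t + 1)) + η • (Aᵀ *ᵥ X t) := by
    rintro (_ | t)
    · rw [hYs, hYs, hXs, hX0, hy1]
      simp only [Matrix.mulVec_sub, hxker, sub_zero]
      abel
    · rw [hYs, hYs, hXs, hXs, hy]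
      simp only [Matrix.mulVec_sub, hxker, sub_zero]
      abel
  have bound : ∀ xs ys, Aᵀ *ᵥ xs = 0 → A *ᵥ ys = 0 → ∀ t,
      sqnorm (x t - xinf) + sqnorm (y t - yinf) ≤ 2 / (1 - c) * ρ ^ t *
        (sqnorm (x 0 - xs) + sqnorm (y 0 - ys) + sqnorm (xm1 - xs) + sqnorm (ym1 - ys)) := by
    intro xs ys hxs hys t
    have h := ogda_sqnorm_le A (η := η) hc1 hc0 hρ0.le
      (fun μ hμ _ => by linarith [hle μ hμ])
      (fun μ hμ hμ0 => by
        rw [hc2, div_mul_eq_mul_div, le_div_iff₀ (by positivity)]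
        nlinarith [hle μ hμ])
      (fun μ hμ hμ0 => by
        rw [hρ, mul_assoc]
        gcongr
        exact hμmin.2 ⟨hμ, hμ0⟩)
      X Y hXrec hYrec (by rwa [hX1]) (by rwa [hY1]) (xs := xs - xinf) (ys := ys - yinf)
      (by rw [Matrix.mulVec_sub, hxs, hxker, sub_zero])
      (by rw [Matrix.mulVec_sub, hys, hyker, sub_zero]) t
    rw [hX0, hY0, hX1, hY1, hXs, hYs] at h
    simpa only [sub_sub_sub_cancel_right] using h
  have hC0 : 0 < 2 / (1 - c) := div_pos two_pos (by linarith)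
  have hlim : Tendsto (fun t => sqnorm (x t - xinf) + sqnorm (y t - yinf)) atTop (nhds 0) := by
    refine squeeze_zero (fun t => add_nonneg (sqnorm_nonneg _) (sqnorm_nonneg _))
      (bound 0 0 (Matrix.mulVec_zero _) (Matrix.mulVec_zero _)) ?_
    have h := ((tendsto_pow_atTop_nhds_zero_of_lt_one hρ0.le hρ1).const_mul
      (2 / (1 - c))).mul_const
      (sqnorm (x 0 - 0) + sqnorm (y 0 - 0) + sqnorm (xm1 - 0) + sqnorm (ym1 - 0))
    simpa only [mul_zero, zero_mul] using h
  refine ⟨xinf, yinf, ?_, hxker, hyker, hxorth, hyorth, fun t => ?_⟩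
  · refine Tendsto.prodMk_nhds (tendsto_of_tendsto_sqnorm ?_) (tendsto_of_tendsto_sqnorm ?_)
    · exact squeeze_zero (fun t => sqnorm_nonneg _)
        (fun t => le_add_of_nonneg_right (sqnorm_nonneg _)) hlim
    · exact squeeze_zero (fun t => sqnorm_nonneg _)
        (fun t => le_add_of_nonneg_left (sqnorm_nonneg _)) hlim
  · have hK : 0 < √(2 / (1 - c)) * √ρ ^ t := by positivity
    rw [mul_right_comm, ← div_le_iff₀' hK, hD]
    refine le_csInf ⟨_, 0, 0, Matrix.mulVec_zero _, Matrix.mulVec_zero _, rfl⟩ ?_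
    rintro d ⟨xs, ys, hxs, hys, rfl⟩
    have hsq : √ρ ^ t = √(ρ ^ t) := by
      rw [eq_comm, Real.sqrt_eq_iff_mul_self_eq (by positivity) (by positivity), ← mul_pow,
        Real.mul_self_sqrt hρ0.le]
    rw [div_le_iff₀' hK, hsq, ← Real.sqrt_mul hC0.le, ← Real.sqrt_mul (by positivity)]
    exact Real.sqrt_le_sqrt (bound xs ys hxs hys t)

end
end

section
/- Let η > 0 and consider the general-sum OGDA for the 1×1 game with A = B = (1), i.e. real sequences with x_{t+1} = x_t + 2η y_t − η y_{t−1} and y_{t+1} = y_t + 2η x_t − η x_{t−1}. If x₀ = y₀, x₋₁ = y₋₁ and x₀ > max{x₋₁, 0}, then x_t = y_t for all t, x_{t+1} > (1+η)·x_t for all t ≥ 0, and x_t → +∞; in particular the general-sum OGDA does not converge for these initializations. -/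
open Filter

/-- **Proposition (non-convergence of general-sum OGDA for `A = B = (1)`).**
For the 1×1 common-payoff game with `A = B = (1)`, if `x₀ = y₀`, `x₋₁ = y₋₁` and
`x₀ > max{x₋₁, 0}`, then `x_t = y_t` for all `t`, `x_{t+1} > (1+η)·x_t` for all
`t ≥ 0`, `x_t → +∞`, and in particular the OGDA iterates do not converge. -/
theorem ogda_general_sum_matching_divergence
    (η : ℝ) (hη : 0 < η) (x y : ℕ → ℝ) (xm1 ym1 : ℝ)
    (hx1 : x 1 = x 0 + 2 * η * y 0 - η * ym1)
    (hy1 : y 1 = y 0 + 2 * η * x 0 - η * xm1)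
    (hx : ∀ t, x (t + 2) = x (t + 1) + 2 * η * y (t + 1) - η * y t)
    (hy : ∀ t, y (t + 2) = y (t + 1) + 2 * η * x (t + 1) - η * x t)
    (h0 : x 0 = y 0) (hm1 : xm1 = ym1) (hpos : x 0 > max xm1 0) :
    (∀ t, x t = y t) ∧
    (∀ t, x (t + 1) > (1 + η) * x t) ∧
    Tendsto x atTop atTop ∧
    ¬ ∃ L : ℝ × ℝ, Tendsto (fun t => (x t, y t)) atTop (nhds L) := by
  obtain ⟨hlt, h0pos⟩ := max_lt_iff.mp hpos
  have hxy : ∀ t, x t = y t ∧ x (t + 1) = y (t + 1) := by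
    intro t
    induction t with
    | zero => exact ⟨h0, by rw [hx1, hy1, h0, hm1]⟩
    | succ t ih => exact ⟨ih.2, by rw [hx, hy, ih.1, ih.2]⟩
  have hgrow : ∀ t, 0 < x t ∧ (1 + η) * x t < x (t + 1) := by
    intro t
    induction t with
    | zero =>
      refine ⟨h0pos, ?_⟩
      rw [zero_add, hx1, ← h0, ← hm1]
      nlinarith [mul_pos hη (sub_pos.mpr hlt)]
    | succ t ih =>
      obtain ⟨hpos_t, hstep⟩ := ih
      have hlt_t : x t < x (t + 1) := by nlinarith [mul_pos hη hpos_t]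
      refine ⟨hpos_t.trans hlt_t, ?_⟩
      rw [hx, ← (hxy t).1, ← (hxy t).2]
      nlinarith [mul_pos hη (sub_pos.mpr hlt_t)]
  have hgeom : ∀ t, (1 + η) ^ t * x 0 ≤ x t := by
    intro t
    induction t with
    | zero => simp
    | succ t ih =>
      calc (1 + η) ^ (t + 1) * x 0 = (1 + η) * ((1 + η) ^ t * x 0) := by ring
        _ ≤ (1 + η) * x t := by gcongr
        _ ≤ x (t + 1) := (hgrow t).2.le
  have htop : Tendsto x atTop atTop :=
    tendsto_atTop_mono hgeom
      ((tendsto_pow_atTop_atTop_of_one_lt (by linarith)).atTop_mul_const h0pos)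
  refine ⟨fun t => (hxy t).1, fun t => (hgrow t).2, htop, ?_⟩
  rintro ⟨L, hL⟩
  exact not_tendsto_nhds_of_tendsto_atTop htop L.1 hL.fst_nhds
end

section
/- Let A, B ∈ ℝ^{n×p} and η > 0, and let Λ_{A,B} be the 2(n+p)×2(n+p) block matrix [[I_n, 2ηA, 0, −ηA], [2ηBᵀ, I_p, −ηBᵀ, 0], [I_n, 0, 0, 0], [0, I_p, 0, 0]]. Then the set of complex eigenvalues of Λ_{A,B} equals the union over μ ∈ Sp(BᵀA) ∪ Sp(ABᵀ) of the sets S*(μ) = {λ ∈ ℂ : λ²(1−λ)² = μ·η²·(1−2λ)²}. -/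
open Matrix Filter

noncomputable section

/-- The OGDA dynamics matrix `Λ_{A,B}` of the general-sum bilinear game
`(xᵀAy, xᵀBy)`:
`[[I_n, 2ηA, 0, −ηA], [2ηBᵀ, I_p, −ηBᵀ, 0], [I_n, 0, 0, 0], [0, I_p, 0, 0]]`. -/
def LamGS {n p : ℕ} (η : ℝ) (A B : Matrix (Fin n) (Fin p) ℝ) :
    Matrix ((Fin n ⊕ Fin p) ⊕ (Fin n ⊕ Fin p)) ((Fin n ⊕ Fin p) ⊕ (Fin n ⊕ Fin p)) ℝ :=
  Matrix.fromBlocks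
    (Matrix.fromBlocks 1 ((2 * η) • A) ((2 * η) • Bᵀ) 1)
    (Matrix.fromBlocks 0 ((-η) • A) ((-η) • Bᵀ) 0)
    (Matrix.fromBlocks 1 0 0 1)
    0

namespace Matrix

variable {K m n : Type*} [Field K] [Fintype m] [DecidableEq m] [Fintype n] [DecidableEq n]

theorem mem_spectrum_iff_det_eq_zero (M : Matrix m m K) (μ : K) :
    μ ∈ spectrum K M ↔ (μ • (1 : Matrix m m K) - M).det = 0 := by
  rw [spectrum.mem_iff, isUnit_iff_isUnit_det, isUnit_iff_ne_zero, not_not,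
    Algebra.algebraMap_eq_smul_one]

theorem det_smul_one_sub_smul_eq_zero_iff (M : Matrix m m K) (a : K) {c : K} (hc : c ≠ 0) :
    (a • (1 : Matrix m m K) - c • M).det = 0 ↔ a / c ∈ spectrum K M := by
  have h : a • (1 : Matrix m m K) - c • M = c • ((a / c) • (1 : Matrix m m K) - M) := by
    rw [smul_sub, smul_smul, mul_div_cancel₀ a hc]
  rw [mem_spectrum_iff_det_eq_zero, h, det_smul]
  simp [hc]

/-- Eigenvalues of the block companion matrix of the quadratic pencil `μ² - μP - Q`. -/
theorem mem_spectrum_fromBlocks_one_zero_iff (P Q : Matrix m m K) (μ : K) :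
    μ ∈ spectrum K (fromBlocks P Q (1 : Matrix m m K) 0) ↔
      (μ ^ 2 • (1 : Matrix m m K) - μ • P - Q).det = 0 := by
  have hR : (fromBlocks (μ • 1) (-1) 1 0 : Matrix (m ⊕ m) (m ⊕ m) K) *
      fromBlocks 0 1 (-1) (μ • 1) = 1 := by
    simp [fromBlocks_multiply, ← fromBlocks_one]
  have hM : (μ • (1 : Matrix (m ⊕ m) (m ⊕ m) K) - fromBlocks P Q 1 0) *
      fromBlocks (μ • 1) (-1) 1 0 =
      fromBlocks (μ ^ 2 • (1 : Matrix m m K) - μ • P - Q) (-(μ • 1 - P)) 0 1 := by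
    rw [← fromBlocks_one, fromBlocks_smul, sub_eq_add_neg, fromBlocks_neg, fromBlocks_add,
      fromBlocks_multiply]
    congr 1 <;> simp [sub_eq_add_neg, smul_smul, pow_two]
  have hR' := left_ne_zero_of_mul_eq_one ((det_mul _ _).symm.trans (hR ▸ det_one))
  have hdet := congrArg det hM
  rw [det_mul, det_fromBlocks_zero₂₁, det_one, mul_one] at hdet
  rw [mem_spectrum_iff_det_eq_zero, ← hdet, mul_eq_zero, or_iff_left hR']

theorem det_fromBlocks_neg_neg (X : Matrix m m K) (A : Matrix m n K) (C : Matrix n m K)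
    (Y : Matrix n n K) : (fromBlocks X (-A) (-C) Y).det = (fromBlocks X A C Y).det := by
  have hS : (fromBlocks 1 0 0 (-1) : Matrix (m ⊕ n) (m ⊕ n) K) * fromBlocks 1 0 0 (-1) = 1 := by
    simp [fromBlocks_multiply, ← fromBlocks_one]
  have h : fromBlocks X (-A) (-C) Y =
      fromBlocks 1 0 0 (-1) * fromBlocks X A C Y * fromBlocks 1 0 0 (-1) := by
    simp [fromBlocks_multiply]
  rw [h, det_mul_right_comm, hS, one_mul]

theorem det_fromBlocks_smul_one_sq (a : K) (A : Matrix m n K) (C : Matrix n m K) :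
    (fromBlocks (a • 1) (-A) (-C) (a • 1)).det ^ 2 =
      (a ^ 2 • (1 : Matrix m m K) - A * C).det * (a ^ 2 • (1 : Matrix n n K) - C * A).det := by
  have h : fromBlocks (a • 1) (-A) (-C) (a • 1) * fromBlocks (a • 1) A C (a • 1) =
      fromBlocks (a ^ 2 • (1 : Matrix m m K) - A * C) 0 0
        (a ^ 2 • (1 : Matrix n n K) - C * A) := by
    rw [fromBlocks_multiply]
    congr 1 <;> simp [sub_eq_add_neg, smul_smul, pow_two, add_comm]
  rw [← det_fromBlocks_zero₂₁ _ 0, ← h, det_mul, ← det_fromBlocks_neg_neg _ A, pow_two]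

end Matrix

theorem LamGS_map_ofReal {n p : ℕ} (η : ℝ) (A B : Matrix (Fin n) (Fin p) ℝ) :
    (LamGS η A B).map Complex.ofReal =
      fromBlocks
        (fromBlocks 1 ((2 * η : ℂ) • A.map Complex.ofReal)
          ((2 * η : ℂ) • (B.map Complex.ofReal)ᵀ) 1)
        (fromBlocks 0 ((-η : ℂ) • A.map Complex.ofReal)
          ((-η : ℂ) • (B.map Complex.ofReal)ᵀ) 0)
        1 0 := by
  ext (i | i) (j | j) <;> rcases i with i | i <;> rcases j with j | j <;>
    simp [LamGS, Matrix.one_apply, apply_ite Complex.ofReal]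

theorem mem_spectrum_LamGS_iff_det {n p : ℕ} (η : ℝ) (A B : Matrix (Fin n) (Fin p) ℝ) (l : ℂ) :
    l ∈ spectrum ℂ ((LamGS η A B).map Complex.ofReal) ↔
      ((l * (1 - l)) ^ 2 • (1 : Matrix (Fin n) (Fin n) ℂ) -
          (η * (1 - 2 * l)) ^ 2 • (A * Bᵀ).map Complex.ofReal).det = 0 ∨
      ((l * (1 - l)) ^ 2 • (1 : Matrix (Fin p) (Fin p) ℂ) -
          (η * (1 - 2 * l)) ^ 2 • (Bᵀ * A).map Complex.ofReal).det = 0 := by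
  have hAB : (A * Bᵀ).map Complex.ofReal = A.map Complex.ofReal * (B.map Complex.ofReal)ᵀ :=
    Matrix.map_mul (f := Complex.ofRealHom)
  have hBA : (Bᵀ * A).map Complex.ofReal = (B.map Complex.ofReal)ᵀ * A.map Complex.ofReal :=
    Matrix.map_mul (f := Complex.ofRealHom)
  rw [LamGS_map_ofReal, mem_spectrum_fromBlocks_one_zero_iff, hAB, hBA]
  generalize A.map Complex.ofReal = A'
  generalize (B.map Complex.ofReal)ᵀ = C
  have h : l ^ 2 • (1 : Matrix (Fin n ⊕ Fin p) (Fin n ⊕ Fin p) ℂ) -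
      l • fromBlocks 1 ((2 * η : ℂ) • A') ((2 * η : ℂ) • C) 1 -
      fromBlocks 0 ((-η : ℂ) • A') ((-η : ℂ) • C) 0 =
      fromBlocks ((-(l * (1 - l))) • 1) (-(-(η * (1 - 2 * l)) • A'))
        (-(-(η * (1 - 2 * l)) • C)) ((-(l * (1 - l))) • 1) := by
    rw [← fromBlocks_one, fromBlocks_smul, fromBlocks_smul, sub_eq_add_neg, sub_eq_add_neg,
      fromBlocks_neg, fromBlocks_neg, fromBlocks_add, fromBlocks_add]
    congr 1 <;> module
  rw [h, ← pow_eq_zero_iff two_ne_zero, det_fromBlocks_smul_one_sq, mul_eq_zero]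
  simp only [Matrix.smul_mul, Matrix.mul_smul, smul_smul, neg_sq, ← pow_two]

/-- **Proposition (spectrum of `Λ_{A,B}`).**
The set of complex eigenvalues of `Λ_{A,B}` is the union, over
`μ ∈ Sp(BᵀA) ∪ Sp(ABᵀ)`, of the sets `S*(μ) = {λ ∈ ℂ : λ²(1−λ)² = μη²(1−2λ)²}`. -/
theorem spectrum_LamGS
    {n p : ℕ} (η : ℝ) (hη : 0 < η) (A B : Matrix (Fin n) (Fin p) ℝ) :
    spectrum ℂ ((LamGS η A B).map Complex.ofReal) =
      ⋃ μ ∈ (spectrum ℂ ((Bᵀ * A).map Complex.ofReal) ∪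
              spectrum ℂ ((A * Bᵀ).map Complex.ofReal)),
        {l : ℂ | l ^ 2 * (1 - l) ^ 2 = μ * (η : ℂ) ^ 2 * (1 - 2 * l) ^ 2} := by
  have hη' : (η : ℂ) ≠ 0 := Complex.ofReal_ne_zero.mpr hη.ne'
  ext l
  simp only [Set.mem_iUnion, Set.mem_union, Set.mem_ofPred_eq, exists_prop,
    mem_spectrum_LamGS_iff_det, ← mul_pow, mul_assoc]
  by_cases hl : 1 - 2 * l = 0
  · obtain rfl : l = 1 / 2 := by linear_combination -hl / 2
    norm_num [det_smul]
  · have hc : ((η : ℂ) * (1 - 2 * l)) ^ 2 ≠ 0 := pow_ne_zero 2 (mul_ne_zero hη' hl)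
    simp only [det_smul_one_sub_smul_eq_zero_iff _ _ hc, ← div_eq_iff hc, exists_eq_right',
      or_comm]

end
end
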